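/- Let m < n be natural numbers and let η : B_m → B_n be the standard geometric embedding. For every nontrivial a ∈ B_m, the image of η(a) in the quotient B_n / Z(B_n) of B_n by its center has infinite order. -/

import Mathlib

/-- The braid relations on generators `σ_1, …, σ_{n-1}`, indexed here by `Fin (n-1)`
(index `i : Fin (n-1)` corresponds to `σ_{i+1}`): far-apart generators commute, and
adjacent generators satisfy the braid relation. -/
def braidRels (n : ℕ) : Set (FreeGroup (Fin (n - 1))) :=
  { r | (∃ i j : Fin (n - 1), (i : ℕ) + 1 < (j : ℕ) ∧
          r = FreeGroup.of i * FreeGroup.of j * (FreeGroup.of i)⁻¹ * (FreeGroup.of j)⁻¹) ∨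
        (∃ i j : Fin (n - 1), (j : ℕ) = (i : ℕ) + 1 ∧
          r = FreeGroup.of i * FreeGroup.of j * FreeGroup.of i *
              (FreeGroup.of j * FreeGroup.of i * FreeGroup.of j)⁻¹) }

/-- The braid group `B_n` on `n` strands, presented by generators and braid relations. -/
abbrev BraidGroup (n : ℕ) : Type := PresentedGroup (braidRels n)

/-- The Artin generator `σ_{i+1}` of `B_n`, for `i : Fin (n-1)`. -/
def braidGen (n : ℕ) (i : Fin (n - 1)) : BraidGroup n := PresentedGroup.of i

/-- Equality of positive braid words on the generators `σ_0, σ_1, …`. -/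
inductive BraidWordEquiv : List ℕ → List ℕ → Prop
  | refl (w : List ℕ) : BraidWordEquiv w w
  | symm {u v : List ℕ} : BraidWordEquiv u v → BraidWordEquiv v u
  | trans {u v w : List ℕ} : BraidWordEquiv u v → BraidWordEquiv v w → BraidWordEquiv u w
  | cons (i : ℕ) {u v : List ℕ} : BraidWordEquiv u v → BraidWordEquiv (i :: u) (i :: v)
  | comm {i j : ℕ} (h : i + 1 < j) (w : List ℕ) : BraidWordEquiv (i :: j :: w) (j :: i :: w)
  | braid (i : ℕ) (w : List ℕ) :
      BraidWordEquiv (i :: (i + 1) :: i :: w) ((i + 1) :: i :: (i + 1) :: w)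

namespace BraidWordEquiv

theorem append_right {u v : List ℕ} (h : BraidWordEquiv u v) (w : List ℕ) :
    BraidWordEquiv (u ++ w) (v ++ w) := by
  induction h with
  | refl u => exact .refl _
  | symm _ ih => exact ih.symm
  | trans _ _ ih₁ ih₂ => exact ih₁.trans ih₂
  | cons i _ ih => exact ih.cons i
  | comm h u => exact .comm h _
  | braid i u => exact .braid i _

theorem append_left {u v : List ℕ} (h : BraidWordEquiv u v) (w : List ℕ) :
    BraidWordEquiv (w ++ u) (w ++ v) := by
  induction w with
  | nil => exact h
  | cons i w ih => exact ih.cons i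

theorem length_eq {u v : List ℕ} (h : BraidWordEquiv u v) : u.length = v.length := by
  induction h <;> simp_all

theorem mem_iff {u v : List ℕ} (h : BraidWordEquiv u v) (i : ℕ) : i ∈ u ↔ i ∈ v := by
  induction h <;> simp_all <;> tauto

/-- Equivalent words have the same value under any assignment that satisfies the braid relations
between the letters that occur. -/
theorem prod_map_eq {A : Type*} [Monoid A] (f : ℕ → A) {u v : List ℕ} (h : BraidWordEquiv u v)
    (hcomm : ∀ i ∈ u, ∀ j ∈ u, i + 1 < j → f i * f j = f j * f i)
    (hbraid : ∀ i ∈ u, i + 1 ∈ u → f i * f (i + 1) * f i = f (i + 1) * f i * f (i + 1)) :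
    (u.map f).prod = (v.map f).prod := by
  induction h with
  | refl u => rfl
  | symm h ih =>
    simp only [h.mem_iff] at ih
    exact (ih hcomm hbraid).symm
  | trans h _ ih₁ ih₂ =>
    simp only [← h.mem_iff] at ih₂
    exact (ih₁ hcomm hbraid).trans (ih₂ hcomm hbraid)
  | cons i _ ih =>
    simp only [List.map_cons, List.prod_cons]
    rw [ih (fun i hi j hj => hcomm i (by simp [hi]) j (by simp [hj]))
      (fun i hi hj => hbraid i (by simp [hi]) (by simp [hj]))]
  | @comm i j h w =>
    simp only [List.map_cons, List.prod_cons, ← mul_assoc]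
    rw [hcomm i (by simp) j (by simp) h]
  | braid i w =>
    simp only [List.map_cons, List.prod_cons, ← mul_assoc]
    rw [hbraid i (by simp) (by simp)]

end BraidWordEquiv

/-- Equality of positive braids as a congruence on the free monoid. -/
def positiveBraidCon : Con (FreeMonoid ℕ) where
  r u v := BraidWordEquiv u.toList v.toList
  iseqv := ⟨fun _ => .refl _, .symm, .trans⟩
  mul' h₁ h₂ := by
    simpa using (h₁.append_right _).trans (h₂.append_left _)

/-- The monoid of positive braids on infinitely many strands. -/
abbrev PositiveBraid : Type := positiveBraidCon.Quotient

namespace PositiveBraid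

/-- The positive braid represented by a word. -/
def ofWord (w : List ℕ) : PositiveBraid := ((FreeMonoid.ofList w : FreeMonoid ℕ) : PositiveBraid)

/-- The generators of the positive braid monoid. -/
def gen (i : ℕ) : PositiveBraid := ofWord [i]

theorem ofWord_eq_iff {u v : List ℕ} : ofWord u = ofWord v ↔ BraidWordEquiv u v :=
  Con.eq positiveBraidCon

theorem ofWord_surjective : Function.Surjective ofWord := fun x => by
  obtain ⟨w, rfl⟩ := Quotient.exists_rep x
  exact ⟨FreeMonoid.toList w, rfl⟩

theorem ofWord_nil : ofWord [] = 1 := rfl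

theorem ofWord_append (u v : List ℕ) : ofWord (u ++ v) = ofWord u * ofWord v := rfl

theorem ofWord_cons (i : ℕ) (w : List ℕ) : ofWord (i :: w) = gen i * ofWord w := rfl

theorem gen_comm {i j : ℕ} (h : i + 1 < j ∨ j + 1 < i) : gen i * gen j = gen j * gen i := by
  rcases h with h | h
  · exact ofWord_eq_iff.2 (.comm h [])
  · exact ofWord_eq_iff.2 (.symm (.comm h []))

theorem gen_braid {i j : ℕ} (h : i + 1 = j ∨ j + 1 = i) :
    gen i * (gen j * gen i) = gen j * (gen i * gen j) := by
  rcases h with rfl | rfl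
  · exact ofWord_eq_iff.2 (.braid i [])
  · exact ofWord_eq_iff.2 (.symm (.braid j []))

theorem gen_comm_assoc {i j : ℕ} (h : i + 1 < j ∨ j + 1 < i) (x : PositiveBraid) :
    gen i * (gen j * x) = gen j * (gen i * x) := by
  rw [← mul_assoc, gen_comm h, mul_assoc]

theorem gen_braid_assoc {i j : ℕ} (h : i + 1 = j ∨ j + 1 = i) (x : PositiveBraid) :
    gen i * (gen j * (gen i * x)) = gen j * (gen i * (gen j * x)) := by
  simpa only [mul_assoc] using congrArg (· * x) (gen_braid h)

/-- The word length of a positive braid. -/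
def length (x : PositiveBraid) : ℕ :=
  Quotient.lift (fun w : FreeMonoid ℕ => w.toList.length)
    (fun _ _ h => BraidWordEquiv.length_eq h) x

@[simp] theorem length_ofWord (w : List ℕ) : length (ofWord w) = w.length := rfl

@[simp] theorem length_gen (i : ℕ) : length (gen i) = 1 := rfl

@[simp] theorem length_mul (x y : PositiveBraid) : length (x * y) = length x + length y := by
  obtain ⟨u, rfl⟩ := ofWord_surjective x
  obtain ⟨v, rfl⟩ := ofWord_surjective y
  simp [← ofWord_append]

theorem eq_one_of_length_eq_zero {x : PositiveBraid} (h : length x = 0) : x = 1 := by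
  obtain ⟨u, rfl⟩ := ofWord_surjective x
  rw [length_ofWord, List.length_eq_zero_iff] at h
  rw [h, ofWord_nil]

theorem eq_one_or_eq_gen_mul (x : PositiveBraid) : x = 1 ∨ ∃ i y, x = gen i * y := by
  obtain ⟨_ | ⟨i, w⟩, rfl⟩ := ofWord_surjective x
  · exact .inl rfl
  · exact .inr ⟨i, ofWord w, rfl⟩

/-- The right complement of `gen i` in the least common right multiple of `gen i` and `gen j`. -/
def complement (i j : ℕ) : PositiveBraid :=
  if i = j then 1 else if i + 1 = j ∨ j + 1 = i then gen j * gen i else gen j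

@[simp] theorem complement_self (i : ℕ) : complement i i = 1 := by simp [complement]

theorem complement_of_adjacent {i j : ℕ} (h : i + 1 = j ∨ j + 1 = i) :
    complement i j = gen j * gen i := by
  rw [complement, if_neg (by omega), if_pos h]

theorem complement_of_far {i j : ℕ} (h : i + 1 < j ∨ j + 1 < i) : complement i j = gen j := by
  rw [complement, if_neg (by omega), if_neg (by omega)]

theorem eq_or_adjacent_or_far (i j : ℕ) :
    i = j ∨ (i + 1 = j ∨ j + 1 = i) ∨ (i + 1 < j ∨ j + 1 < i) := by omega

theorem gen_mul_complement (i j : ℕ) : gen i * complement i j = gen j * complement j i := by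
  rcases eq_or_adjacent_or_far i j with rfl | h | h
  · rfl
  · rw [complement_of_adjacent h, complement_of_adjacent h.symm, gen_braid h]
  · rw [complement_of_far h, complement_of_far h.symm, gen_comm h]

/-- `x` and `y` arise from a common right multiple `gen i * x = gen j * y` through the least
common right multiple of `gen i` and `gen j`. -/
def Factors (i j : ℕ) (x y : PositiveBraid) : Prop :=
  ∃ z, x = complement i j * z ∧ y = complement j i * z

theorem Factors.symm {i j : ℕ} {x y : PositiveBraid} (h : Factors i j x y) : Factors j i y x :=
  let ⟨z, hx, hy⟩ := h
  ⟨z, hy, hx⟩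

theorem Factors.eq {i : ℕ} {x y : PositiveBraid} (h : Factors i i x y) : x = y := by
  obtain ⟨z, rfl, rfl⟩ := h
  rfl

theorem Factors.of_adjacent {i j : ℕ} {x y : PositiveBraid} (h : Factors i j x y)
    (hij : i + 1 = j ∨ j + 1 = i) :
    ∃ z, x = gen j * (gen i * z) ∧ y = gen i * (gen j * z) := by
  obtain ⟨z, rfl, rfl⟩ := h
  exact ⟨z, by rw [complement_of_adjacent hij, mul_assoc],
    by rw [complement_of_adjacent hij.symm, mul_assoc]⟩

theorem Factors.of_far {i j : ℕ} {x y : PositiveBraid} (h : Factors i j x y)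
    (hij : i + 1 < j ∨ j + 1 < i) : ∃ z, x = gen j * z ∧ y = gen i * z := by
  obtain ⟨z, rfl, rfl⟩ := h
  exact ⟨z, by rw [complement_of_far hij], by rw [complement_of_far hij.symm]⟩

theorem factors_of_adjacent {i j : ℕ} (hij : i + 1 = j ∨ j + 1 = i) {x y : PositiveBraid}
    (z : PositiveBraid) (hx : x = gen j * (gen i * z)) (hy : y = gen i * (gen j * z)) :
    Factors i j x y :=
  ⟨z, by rw [complement_of_adjacent hij, mul_assoc, hx],
    by rw [complement_of_adjacent hij.symm, mul_assoc, hy]⟩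

theorem factors_of_far {i j : ℕ} (hij : i + 1 < j ∨ j + 1 < i) {x y : PositiveBraid}
    (z : PositiveBraid) (hx : x = gen j * z) (hy : y = gen i * z) : Factors i j x y :=
  ⟨z, by rw [complement_of_far hij, hx], by rw [complement_of_far hij.symm, hy]⟩

/-- The cube condition, assuming the factorization property in smaller lengths. -/
theorem Factors.trans {n : ℕ}
    (ih : ∀ (i j : ℕ) (x y : PositiveBraid), length x < n → gen i * x = gen j * y →
      Factors i j x y)
    {a b c : ℕ} {x w y : PositiveBraid} (hn : length x = n) (h₁ : Factors a c x w)
    (h₂ : Factors c b w y) : Factors a b x y := by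
  rcases eq_or_adjacent_or_far a c with rfl | hac
  · rwa [h₁.eq]
  rcases eq_or_adjacent_or_far c b with rfl | hcb
  · rwa [← h₂.eq]
  rcases hac with hac | hac <;> rcases hcb with hcb | hcb
  · obtain ⟨u, rfl, rfl⟩ := h₁.of_adjacent hac
    obtain ⟨v, hw, rfl⟩ := h₂.of_adjacent hcb
    simp only [length_mul, length_gen] at hn
    have hl := congrArg length hw
    simp only [length_mul, length_gen] at hl
    rcases eq_or_adjacent_or_far a b with rfl | hab | hab
    · obtain rfl := (ih _ _ _ _ (by omega) (ih _ _ _ _ (by simp; omega) hw).eq).eq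
      exact ⟨_, by rw [complement_self, one_mul], by rw [complement_self, one_mul]⟩
    · omega
    · obtain ⟨z, e₁, e₂⟩ := (ih _ _ _ _ (by simp; omega) hw).of_far hab
      obtain ⟨p, rfl, rfl⟩ := (ih _ _ _ _ (by omega) e₁).of_adjacent hcb
      simp only [length_mul, length_gen] at hn hl
      obtain ⟨q, rfl, e₃⟩ := (ih _ _ _ _ (by omega) e₂).of_adjacent hac.symm
      obtain ⟨r, rfl, rfl⟩ := (ih _ _ _ _ (by omega)
        (ih _ _ _ _ (by simp; omega) e₃).eq).of_far hab.symm
      refine factors_of_far hab (gen c * (gen b * (gen a * (gen c * r)))) ?_ ?_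
      · rw [gen_comm_assoc hab (gen c * _), gen_braid_assoc hac, gen_braid_assoc hcb]
      · rw [gen_comm_assoc hab.symm (gen c * _), gen_braid_assoc hcb.symm,
          gen_braid_assoc hac.symm, gen_comm_assoc hab]
  · obtain ⟨u, rfl, rfl⟩ := h₁.of_adjacent hac
    obtain ⟨v, hw, rfl⟩ := h₂.of_far hcb
    simp only [length_mul, length_gen] at hn
    have hl := congrArg length hw
    simp only [length_mul, length_gen] at hl
    rcases eq_or_adjacent_or_far a b with rfl | hab | hab
    · omega
    · obtain ⟨z, e₁, rfl⟩ := (ih _ _ _ _ (by simp; omega) hw).of_adjacent hab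
      obtain ⟨p, rfl, e₂⟩ := (ih _ _ _ _ (by omega) e₁).of_far hcb
      simp only [length_mul, length_gen] at hn hl
      obtain ⟨q, rfl, rfl⟩ := (ih _ _ _ _ (by omega) e₂).of_adjacent hac
      refine factors_of_adjacent hab (gen c * (gen a * (gen b * q))) ?_ ?_
      · rw [gen_braid_assoc hab, gen_comm_assoc hcb (gen a * _),
          gen_comm_assoc hcb.symm q, gen_braid_assoc hac (gen b * q)]
      · rw [gen_comm_assoc hcb.symm, gen_comm_assoc hcb.symm, gen_braid_assoc hab.symm,
          gen_braid_assoc hac]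
    · obtain ⟨z, e₁, rfl⟩ := (ih _ _ _ _ (by simp; omega) hw).of_far hab
      obtain ⟨p, rfl, rfl⟩ := (ih _ _ _ _ (by omega) e₁).of_far hcb
      refine factors_of_far hab (gen c * (gen a * p)) ?_ ?_
      · rw [gen_comm_assoc hab, gen_comm_assoc hcb]
      · rw [gen_braid_assoc hac]
  · obtain ⟨u, rfl, rfl⟩ := h₁.of_far hac
    obtain ⟨v, hw, rfl⟩ := h₂.of_adjacent hcb
    simp only [length_mul, length_gen] at hn
    have hl := congrArg length hw
    simp only [length_mul, length_gen] at hl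
    rcases eq_or_adjacent_or_far a b with rfl | hab | hab
    · omega
    · obtain ⟨z, rfl, e₁⟩ := (ih _ _ _ _ (by omega) hw).of_adjacent hab
      simp only [length_mul, length_gen] at hn hl
      obtain ⟨p, rfl, e₂⟩ := (ih _ _ _ _ (by omega) e₁).of_far hac.symm
      simp only [length_mul, length_gen] at hn hl
      obtain ⟨q, rfl, rfl⟩ := (ih _ _ _ _ (by omega) e₂).of_adjacent hcb.symm
      refine factors_of_adjacent hab (gen c * (gen b * (gen a * q))) ?_ ?_
      · rw [gen_comm_assoc hac, gen_comm_assoc hac, gen_braid_assoc hab, gen_braid_assoc hcb.symm]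
      · rw [gen_braid_assoc hab.symm, gen_comm_assoc hac.symm, gen_comm_assoc hac q,
          gen_braid_assoc hcb.symm]
    · obtain ⟨z, rfl, e₁⟩ := (ih _ _ _ _ (by omega) hw).of_far hab
      simp only [length_mul, length_gen] at hn hl
      obtain ⟨p, rfl, rfl⟩ := (ih _ _ _ _ (by omega) e₁).of_far hac.symm
      refine factors_of_far hab (gen c * (gen b * p)) ?_ ?_
      · rw [gen_braid_assoc hcb]
      · rw [gen_comm_assoc hab.symm, gen_comm_assoc hac]
  · obtain ⟨u, rfl, rfl⟩ := h₁.of_far hac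
    obtain ⟨v, hw, rfl⟩ := h₂.of_far hcb
    simp only [length_mul, length_gen] at hn
    rcases eq_or_adjacent_or_far a b with rfl | hab | hab
    · obtain rfl := (ih _ _ _ _ (by omega) hw).eq
      exact ⟨_, by rw [complement_self, one_mul], by rw [complement_self, one_mul]⟩
    · obtain ⟨z, rfl, rfl⟩ := (ih _ _ _ _ (by omega) hw).of_adjacent hab
      refine factors_of_adjacent hab (gen c * z) ?_ ?_
      · rw [gen_comm_assoc hcb, gen_comm_assoc hac]
      · rw [gen_comm_assoc hac.symm, gen_comm_assoc hcb]
    · obtain ⟨z, rfl, rfl⟩ := (ih _ _ _ _ (by omega) hw).of_far hab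
      refine factors_of_far hab (gen c * z) ?_ ?_
      · rw [gen_comm_assoc hcb]
      · rw [gen_comm_assoc hac]

/-- Garside's theorem: a common right multiple of two generators is a right multiple of their least
common right multiple. -/
theorem factors_of_gen_mul_eq {i j : ℕ} {x y : PositiveBraid} (h : gen i * x = gen j * y) :
    Factors i j x y := by
  induction hn : length x using Nat.strong_induction_on generalizing i j x y with
  | _ n ih =>
  have ih' : ∀ (i j : ℕ) (x y : PositiveBraid), length x < n → gen i * x = gen j * y →
      Factors i j x y := fun i j x y hx h => ih _ hx h rfl
  have key : ∀ u v : List ℕ, BraidWordEquiv u v → u.length = n + 1 →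
      ∃ i x j y, u = i :: x ∧ v = j :: y ∧ Factors i j (ofWord x) (ofWord y) := by
    intro u v huv
    induction huv with
    | refl w =>
      intro hw
      obtain ⟨i, x, rfl⟩ := List.exists_cons_of_length_eq_add_one hw
      exact ⟨i, x, i, x, rfl, rfl, ofWord x, by simp⟩
    | symm h ih₁ =>
      intro hw
      obtain ⟨i, x, j, y, hu, hv, hf⟩ := ih₁ (h.length_eq.trans hw)
      exact ⟨j, y, i, x, hv, hu, hf.symm⟩
    | trans h _ ih₁ ih₂ =>
      intro hw
      obtain ⟨a, x, c, w, rfl, rfl, hf⟩ := ih₁ hw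
      obtain ⟨c', w', b, y, hc, rfl, hf'⟩ := ih₂ (h.length_eq.symm.trans hw)
      obtain ⟨rfl, rfl⟩ := List.cons_eq_cons.1 hc
      exact ⟨a, x, b, y, rfl, rfl, hf.trans ih' (by simpa using hw) hf'⟩
    | @cons i u v h _ =>
      intro _
      exact ⟨i, u, i, v, rfl, rfl, ofWord u, by simp, by simp [ofWord_eq_iff.2 h]⟩
    | @comm i j h w =>
      intro _
      exact ⟨i, j :: w, j, i :: w, rfl, rfl, factors_of_far (.inl h) (ofWord w) rfl rfl⟩
    | braid i w =>
      intro _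
      exact ⟨i, _, i + 1, _, rfl, rfl, factors_of_adjacent (.inl rfl) (ofWord w) rfl rfl⟩
  obtain ⟨u, rfl⟩ := ofWord_surjective x
  obtain ⟨v, rfl⟩ := ofWord_surjective y
  obtain ⟨i', x, j', y, hu, hv, hf⟩ :=
    key (i :: u) (j :: v) (ofWord_eq_iff.1 h) (by simpa using hn)
  obtain ⟨rfl, rfl⟩ := List.cons_eq_cons.1 hu
  obtain ⟨rfl, rfl⟩ := List.cons_eq_cons.1 hv
  exact hf

theorem mul_left_cancel' {x y z : PositiveBraid} (h : x * y = x * z) : y = z := by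
  obtain ⟨w, rfl⟩ := ofWord_surjective x
  induction w with
  | nil => simpa [ofWord_nil] using h
  | cons i w ih =>
    rw [ofWord_cons, mul_assoc, mul_assoc] at h
    exact ih (factors_of_gen_mul_eq h).eq

theorem gen_mul_complement_dvd {i j : ℕ} {x : PositiveBraid} (hi : gen i ∣ x) (hj : gen j ∣ x) :
    gen i * complement i j ∣ x := by
  obtain ⟨y, rfl⟩ := hi
  obtain ⟨z, hz⟩ := hj
  obtain ⟨w, rfl, -⟩ := factors_of_gen_mul_eq hz
  exact ⟨w, (mul_assoc _ _ _).symm⟩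

theorem mul_dvd_mul_iff {x y z : PositiveBraid} : x * y ∣ x * z ↔ y ∣ z := by
  constructor
  · rintro ⟨w, hw⟩
    exact ⟨w, mul_left_cancel' (hw.trans (mul_assoc _ _ _))⟩
  · rintro ⟨w, rfl⟩
    exact ⟨w, (mul_assoc _ _ _).symm⟩

/-- The common left divisors of a nonempty family are directed under divisibility. -/
theorem exists_common_dvd {ι : Type*} (k : ι) (s : ι → PositiveBraid) {d e : PositiveBraid}
    (hd : ∀ i, d ∣ s i) (he : ∀ i, e ∣ s i) : ∃ f, d ∣ f ∧ e ∣ f ∧ ∀ i, f ∣ s i := by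
  induction hn : length (s k) using Nat.strong_induction_on generalizing s d e with
  | _ n ih =>
  rcases eq_one_or_eq_gen_mul d with rfl | ⟨a, d, rfl⟩
  · exact ⟨e, one_dvd e, dvd_rfl, he⟩
  rcases eq_one_or_eq_gen_mul e with rfl | ⟨b, e, rfl⟩
  · exact ⟨_, dvd_rfl, one_dvd _, hd⟩
  have hm : ∀ i, gen a * complement a b ∣ s i := fun i =>
    gen_mul_complement_dvd (dvd_of_mul_right_dvd (hd i)) (dvd_of_mul_right_dvd (he i))
  choose t ht using hm
  have ha : ∀ i, s i = gen a * (complement a b * t i) := fun i => by rw [ht, mul_assoc]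
  have hb : ∀ i, s i = gen b * (complement b a * t i) := fun i => by
    rw [ht, gen_mul_complement, mul_assoc]
  have hla := congrArg length (ha k)
  have hlb := congrArg length (hb k)
  simp only [length_mul, length_gen] at hla hlb
  obtain ⟨f, hdf, ⟨f', rfl⟩, hf⟩ := ih _ (by simp only [length_mul]; omega)
    (fun i => complement a b * t i) (d := d) (e := complement a b)
    (fun i => mul_dvd_mul_iff.1 (ha i ▸ hd i)) (fun i => dvd_mul_right _ _) rfl
  obtain ⟨g, heg, ⟨g', rfl⟩, hg⟩ := ih _ (by simp only [length_mul]; omega)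
    (fun i => complement b a * t i) (d := e) (e := complement b a)
    (fun i => mul_dvd_mul_iff.1 (hb i ▸ he i)) (fun i => dvd_mul_right _ _) rfl
  obtain ⟨h, hfh, hgh, hh⟩ := ih _ (by omega) t (d := f') (e := g')
    (fun i => mul_dvd_mul_iff.1 (hf i)) (fun i => mul_dvd_mul_iff.1 (hg i)) rfl
  refine ⟨gen a * complement a b * h, ?_, ?_, fun i => ht i ▸ mul_dvd_mul_iff.2 (hh i)⟩
  · rw [mul_assoc]
    exact mul_dvd_mul_iff.2 (hdf.trans (mul_dvd_mul_iff.2 hfh))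
  · rw [gen_mul_complement, mul_assoc]
    exact mul_dvd_mul_iff.2 (heg.trans (mul_dvd_mul_iff.2 hgh))

/-- The Coxeter braid `σ_k σ_{k+1} ⋯ σ_{k+n-1}`. -/
def coxeter (k : ℕ) : ℕ → PositiveBraid
  | 0 => 1
  | n + 1 => coxeter k n * gen (k + n)

theorem gen_commute_coxeter {j k n : ℕ} (h : k + n < j) : Commute (gen j) (coxeter k n) := by
  induction n with
  | zero => exact Commute.one_right _
  | succ n ih => exact (ih (by omega)).mul_right (gen_comm (.inr (by omega)))

theorem coxeter_semiconjBy {i n : ℕ} (h : i + 1 < n) :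
    SemiconjBy (coxeter 0 n) (gen i) (gen (i + 1)) := by
  induction n with
  | zero => omega
  | succ n ih =>
    rcases Nat.lt_succ_iff_lt_or_eq.1 h with h | rfl
    · exact (ih h).mul_left (by rw [zero_add]; exact gen_comm (.inr (by omega)))
    · have hc : Commute (coxeter 0 i) (gen (i + 1)) := (gen_commute_coxeter (by omega)).symm
      simp only [coxeter, zero_add, SemiconjBy, mul_assoc]
      rw [gen_braid (.inl rfl), ← mul_assoc, hc.eq, mul_assoc]

theorem coxeter_mul_coxeter {k n : ℕ} (h : k < n) :
    coxeter 0 n * coxeter 0 k = coxeter 1 k * coxeter 0 n := by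
  induction k with
  | zero => simp [coxeter]
  | succ k ih =>
    rw [coxeter, coxeter, ← mul_assoc, ih (by omega), mul_assoc, zero_add,
      (coxeter_semiconjBy h).eq, mul_assoc, add_comm 1 k]

theorem coxeter_succ_eq (n : ℕ) : coxeter 0 (n + 1) = gen 0 * coxeter 1 n := by
  induction n with
  | zero => simp [coxeter]
  | succ n ih => rw [coxeter, ih, coxeter, mul_assoc, zero_add, add_comm 1 n]

theorem coxeter_sq_semiconjBy (n : ℕ) :
    SemiconjBy (coxeter 0 (n + 1) ^ 2) (gen n) (gen 0) := by
  have h : coxeter 0 (n + 1) ^ 2 = coxeter 1 n * coxeter 0 (n + 1) * gen n := by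
    rw [← coxeter_mul_coxeter (Nat.lt_succ_self n), mul_assoc, sq]
    simp [coxeter]
  rw [SemiconjBy]
  nth_rw 2 [h]
  rw [← mul_assoc, ← mul_assoc, ← coxeter_succ_eq, sq]

theorem coxeter_pow_semiconjBy {i j n : ℕ} (h : i + j ≤ n) :
    SemiconjBy (coxeter 0 (n + 1) ^ j) (gen i) (gen (i + j)) := by
  induction j with
  | zero => simp
  | succ j ih =>
    rw [pow_succ']
    exact (coxeter_semiconjBy (i := i + j) (by omega)).mul_left (ih (by omega))

/-- The full twist on the strands moved by `σ_0, …, σ_n`. -/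
def fullTwist (n : ℕ) : PositiveBraid := coxeter 0 (n + 1) ^ (n + 2)

theorem fullTwist_commute_gen {i n : ℕ} (h : i ≤ n) : Commute (fullTwist n) (gen i) := by
  obtain ⟨j, rfl⟩ := Nat.exists_eq_add_of_le h
  have h₁ := coxeter_pow_semiconjBy (i := i) (j := j) le_rfl
  have h₂ := coxeter_pow_semiconjBy (i := 0) (j := i) (n := i + j) (by omega)
  rw [zero_add] at h₂
  have := (h₂.mul_left (coxeter_sq_semiconjBy _)).mul_left h₁
  rwa [← pow_add, ← pow_add, show i + 2 + j = i + j + 2 by omega] at this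

theorem gen_dvd_fullTwist {i n : ℕ} (h : i ≤ n) : gen i ∣ fullTwist n := by
  have h₁ := coxeter_pow_semiconjBy (i := 0) (j := i) (n := n) (by omega)
  rw [zero_add] at h₁
  refine ⟨coxeter 0 (n + 1) ^ i * coxeter 1 n * coxeter 0 (n + 1) ^ (n + 1 - i), ?_⟩
  rw [← mul_assoc, ← mul_assoc, ← h₁.eq, mul_assoc _ (gen 0), ← coxeter_succ_eq, ← pow_succ,
    ← pow_add, fullTwist]
  congr 1
  omega

/-- Positive braids represented by a word in `σ_0, …, σ_n`. -/
def bounded (n : ℕ) : Submonoid PositiveBraid where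
  carrier := {x | ∃ w : List ℕ, (∀ i ∈ w, i ≤ n) ∧ ofWord w = x}
  one_mem' := ⟨[], by simp, rfl⟩
  mul_mem' := by
    rintro _ _ ⟨u, hu, rfl⟩ ⟨v, hv, rfl⟩
    exact ⟨u ++ v, fun i hi => (List.mem_append.1 hi).elim (hu i) (hv i), rfl⟩

theorem ofWord_mem_bounded_iff {n : ℕ} {w : List ℕ} :
    ofWord w ∈ bounded n ↔ ∀ i ∈ w, i ≤ n := by
  refine ⟨?_, fun h => ⟨w, h, rfl⟩⟩
  rintro ⟨u, hu, h⟩ i hi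
  exact hu i (((ofWord_eq_iff.1 h).mem_iff i).2 hi)

theorem mul_mem_bounded_iff {n : ℕ} {x y : PositiveBraid} :
    x * y ∈ bounded n ↔ x ∈ bounded n ∧ y ∈ bounded n := by
  obtain ⟨u, rfl⟩ := ofWord_surjective x
  obtain ⟨v, rfl⟩ := ofWord_surjective y
  simp only [← ofWord_append, ofWord_mem_bounded_iff, List.mem_append, or_imp, forall_and]

theorem gen_mem_bounded {i n : ℕ} (h : i ≤ n) : gen i ∈ bounded n :=
  ofWord_mem_bounded_iff.2 (by simpa using h)

theorem bounded_mono : Monotone bounded := fun _ _ h _ ⟨w, hw, e⟩ =>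
  ⟨w, fun i hi => (hw i hi).trans h, e⟩

theorem exists_mem_bounded (x : PositiveBraid) : ∃ n, x ∈ bounded n := by
  obtain ⟨w, rfl⟩ := ofWord_surjective x
  exact ⟨w.sum, ofWord_mem_bounded_iff.2 fun i hi => List.single_le_sum (by simp) i hi⟩

theorem coxeter_mem_bounded {n k : ℕ} (h : k ≤ n + 1) : coxeter 0 k ∈ bounded n := by
  induction k with
  | zero => exact one_mem _
  | succ k ih => exact mul_mem (ih (by omega)) (gen_mem_bounded (by omega))

theorem fullTwist_mem_bounded (n : ℕ) : fullTwist n ∈ bounded n :=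
  pow_mem (coxeter_mem_bounded le_rfl) _

theorem bounded_induction {n : ℕ} {P : PositiveBraid → Prop} (one : P 1)
    (mul : ∀ i ≤ n, ∀ x ∈ bounded n, P x → P (gen i * x)) {x : PositiveBraid}
    (hx : x ∈ bounded n) : P x := by
  obtain ⟨w, hw, rfl⟩ := hx
  induction w with
  | nil => exact one
  | cons i w ih =>
    simp only [List.mem_cons, forall_eq_or_imp] at hw
    exact mul i hw.1 _ ⟨w, hw.2, rfl⟩ (ih hw.2)

theorem fullTwist_commute {n : ℕ} {x : PositiveBraid} (hx : x ∈ bounded n) :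
    Commute (fullTwist n) x :=
  bounded_induction (Commute.one_right _)
    (fun _ hi _ _ ih => (fullTwist_commute_gen hi).mul_right ih) hx

theorem exists_mul_eq_fullTwist_pow {n : ℕ} {x : PositiveBraid} (hx : x ∈ bounded n) :
    ∃ y k, x * y = fullTwist n ^ k := by
  refine bounded_induction (P := fun x => ∃ y k, x * y = fullTwist n ^ k)
    ⟨1, 0, by simp⟩ ?_ hx
  rintro i hi x - ⟨y, k, h⟩
  obtain ⟨z, hz⟩ := gen_dvd_fullTwist hi
  refine ⟨y * z, k + 1, ?_⟩
  rw [mul_assoc, ← mul_assoc x, h, ← mul_assoc, ← ((fullTwist_commute_gen hi).pow_left k).eq,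
    mul_assoc, ← hz, pow_succ]

theorem exists_common_right_multiple {n : ℕ} {x y : PositiveBraid} (hx : x ∈ bounded n)
    (hy : y ∈ bounded n) :
    ∃ u ∈ bounded n, ∃ v ∈ bounded n, x * u = y * v := by
  obtain ⟨u, k, hu⟩ := exists_mul_eq_fullTwist_pow hx
  obtain ⟨v, l, hv⟩ := exists_mul_eq_fullTwist_pow hy
  have hT := fullTwist_mem_bounded n
  refine ⟨u * fullTwist n ^ l, mul_mem ?_ (pow_mem hT _), v * fullTwist n ^ k,
    mul_mem ?_ (pow_mem hT _), ?_⟩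
  · exact (mul_mem_bounded_iff.1 (hu ▸ pow_mem hT k)).2
  · exact (mul_mem_bounded_iff.1 (hv ▸ pow_mem hT l)).2
  · rw [← mul_assoc, ← mul_assoc, hu, hv, ← pow_add, ← pow_add, add_comm]

theorem exists_common_left_multiple (x y : PositiveBraid) : ∃ u v, u * x = v * y := by
  obtain ⟨m, hm⟩ := exists_mem_bounded x
  obtain ⟨n, hn⟩ := exists_mem_bounded y
  have hx := bounded_mono (le_max_left m n) hm
  have hy := bounded_mono (le_max_right m n) hn
  obtain ⟨t, k, ht⟩ := exists_mul_eq_fullTwist_pow hy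
  refine ⟨fullTwist (max m n) ^ k, x * t, ?_⟩
  have h : t * y = fullTwist (max m n) ^ k := mul_left_cancel' (x := y) (by
    rw [← mul_assoc, ht, ((fullTwist_commute hy).pow_left k).eq])
  rw [((fullTwist_commute hx).pow_left k).eq, mul_assoc, h]

theorem mul_right_cancel' {x y z : PositiveBraid} (h : x * z = y * z) : x = y := by
  obtain ⟨l, hl⟩ := exists_mem_bounded x
  obtain ⟨m, hm⟩ := exists_mem_bounded y
  obtain ⟨n, hn⟩ := exists_mem_bounded z
  have hx := bounded_mono ((le_max_left l m).trans (le_max_left _ n)) hl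
  have hy := bounded_mono ((le_max_right l m).trans (le_max_left _ n)) hm
  have hz := bounded_mono (le_max_right (max l m) n) hn
  obtain ⟨t, k, ht⟩ := exists_mul_eq_fullTwist_pow hz
  have h' := congrArg (· * t) h
  simp only [mul_assoc, ht, ← ((fullTwist_commute hx).pow_left k).eq,
    ← ((fullTwist_commute hy).pow_left k).eq] at h'
  exact mul_left_cancel' h'

noncomputable instance : OreLocalization.OreSet (⊤ : Submonoid PositiveBraid) where
  ore_right_cancel _ _ _ h := ⟨1, by rw [mul_right_cancel' h]⟩
  oreDenom x y := ⟨(exists_common_left_multiple x y).choose, trivial⟩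
  oreNum x y := (exists_common_left_multiple x y).choose_spec.choose
  ore_eq x y := (exists_common_left_multiple x y).choose_spec.choose_spec

end PositiveBraid

/-- The group of fractions of the positive braid monoid, that is, the braid group on infinitely
many strands. -/
abbrev StableBraidGroup : Type := (OreLocalization (⊤ : Submonoid PositiveBraid) PositiveBraid)ˣ

namespace StableBraidGroup

open PositiveBraid

/-- The inclusion of positive braids into the stable braid group. -/
noncomputable def ofPositive : PositiveBraid →* StableBraidGroup where
  toFun x := OreLocalization.numeratorUnit ⟨x, trivial⟩
  map_one' := Units.ext (map_one OreLocalization.numeratorHom)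
  map_mul' x y := Units.ext (map_mul OreLocalization.numeratorHom x y)

theorem ofPositive_injective : Function.Injective ofPositive := fun x y h => by
  have h' : OreLocalization.oreDiv x (1 : (⊤ : Submonoid PositiveBraid)) =
    OreLocalization.oreDiv y 1 := congrArg Units.val h
  obtain ⟨u, v, h₁, h₂⟩ := OreLocalization.oreDiv_eq_iff.1 h'
  have h₃ : (u : PositiveBraid) = v := by simpa using h₂
  rw [Submonoid.smul_def, h₃] at h₁
  exact (mul_left_cancel' h₁).symm

theorem exists_ofPositive_mul (g : StableBraidGroup) :
    ∃ x y, ofPositive x * g = ofPositive y := by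
  obtain ⟨g, g', h₁, h₂⟩ := g
  induction g using OreLocalization.ind with
  | _ r s => exact ⟨s, r, Units.ext (by
      simp [ofPositive, OreLocalization.numeratorUnit, Units.val_mul])⟩

/-- The word length as a homomorphism to the integers. -/
def lengthHom : PositiveBraid →* Multiplicative ℤ where
  toFun x := Multiplicative.ofAdd (length x : ℤ)
  map_one' := rfl
  map_mul' x y := by simp [ofAdd_add]

/-- The exponent sum of a braid. -/
noncomputable def degree : StableBraidGroup →* Multiplicative ℤ :=
  (OreLocalization.universalMulHom lengthHom
    (toUnits.toMonoidHom.comp (lengthHom.comp (Submonoid.subtype ⊤)))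
    (fun _ => rfl)).comp (Units.coeHom _)

theorem degree_ofPositive (x : PositiveBraid) :
    degree (ofPositive x) = Multiplicative.ofAdd (length x : ℤ) :=
  OreLocalization.universalMulHom_commutes lengthHom _ fun _ => rfl

theorem exists_forall_ofPositive_mul (g : ℕ → StableBraidGroup) (k : ℕ) :
    ∃ x, ∀ i < k, ∃ y, ofPositive x * g i = ofPositive y := by
  induction k with
  | zero => exact ⟨1, by simp⟩
  | succ k ih =>
    obtain ⟨x, hx⟩ := ih
    obtain ⟨u, v, h⟩ := exists_ofPositive_mul (ofPositive x * g k)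
    refine ⟨u * x, fun i hi => ?_⟩
    rcases Nat.lt_succ_iff_lt_or_eq.1 hi with hi | rfl
    · obtain ⟨y, hy⟩ := hx i hi
      exact ⟨u * y, by rw [map_mul, mul_assoc, hy, map_mul]⟩
    · exact ⟨v, by rw [map_mul, mul_assoc, h]⟩

/-- The left divisibility order of the stable braid group has directed sets of lower bounds. -/
theorem exists_common_mul {ι : Type*} [Nonempty ι] (s : ι → StableBraidGroup)
    {d e : StableBraidGroup} (hd : ∀ i, ∃ x, d * ofPositive x = s i)
    (he : ∀ i, ∃ x, e * ofPositive x = s i) :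
    ∃ x y, d * ofPositive x = e * ofPositive y ∧
      ∀ i, ∃ z, d * ofPositive x * ofPositive z = s i := by
  obtain ⟨c, hc⟩ := exists_forall_ofPositive_mul (fun i => if i = 0 then d else e) 2
  obtain ⟨p, hp⟩ := hc 0 (by omega)
  obtain ⟨q, hq⟩ := hc 1 (by omega)
  simp only [if_true, one_ne_zero, if_false] at hp hq
  choose x hx using hd
  choose y hy using he
  have hxy : ∀ i, p * x i = q * y i := fun i => ofPositive_injective (by
    rw [map_mul, map_mul, ← hp, ← hq, mul_assoc, mul_assoc, hx, hy])
  obtain ⟨f, ⟨u, rfl⟩, ⟨v, huv⟩, hf⟩ := exists_common_dvd (Classical.arbitrary ι)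
    (fun i => p * x i) (d := p) (e := q) (fun i => dvd_mul_right _ _)
    (fun i => hxy i ▸ dvd_mul_right _ _)
  refine ⟨u, v, mul_left_cancel (a := ofPositive c) ?_, fun i => ?_⟩
  · rw [← mul_assoc, ← mul_assoc, hp, hq, ← map_mul, ← map_mul, huv]
  · obtain ⟨z, hz⟩ := hf i
    refine ⟨z, mul_left_cancel (a := ofPositive c) ?_⟩
    rw [← hx i, ← mul_assoc, ← mul_assoc, ← mul_assoc, hp, ← map_mul, ← map_mul, ← map_mul, hz]

theorem eq_one_of_pow_eq_one {g : StableBraidGroup} {k : ℕ} (hk : 0 < k) (hg : g ^ k = 1) :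
    g = 1 := by
  let L : Set StableBraidGroup := {d | ∀ i : ℕ, ∃ x, d * ofPositive x = g ^ i}
  let deg : StableBraidGroup → ℤ := fun d => Multiplicative.toAdd (degree d)
  have deg_mul : ∀ d x, deg (d * ofPositive x) = deg d + length x := fun d x => by
    simp [deg, degree_ofPositive]
  have hL : L.Nonempty := by
    obtain ⟨c, hc⟩ := exists_forall_ofPositive_mul (fun i => g ^ i) k
    refine ⟨(ofPositive c)⁻¹, fun i => ?_⟩
    obtain ⟨y, hy⟩ := hc (i % k) (Nat.mod_lt _ hk)
    exact ⟨y, by rw [← hy, inv_mul_cancel_left, ← pow_eq_pow_mod i hg]⟩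
  have hbound : ∀ z, (∃ d ∈ L, deg d = z) → z ≤ 0 := by
    rintro _ ⟨d, hd, rfl⟩
    obtain ⟨x, hx⟩ := hd 0
    have := deg_mul d x
    rw [hx, pow_zero] at this
    simp only [deg, map_one, toAdd_one] at this ⊢
    omega
  obtain ⟨_, ⟨d, hd, rfl⟩, hmax⟩ := Int.exists_greatest_of_bdd (P := fun z => ∃ d ∈ L, deg d = z)
    ⟨0, hbound⟩ (hL.elim fun d hd => ⟨_, d, hd, rfl⟩)
  have hgd : g * d ∈ L := by
    rintro (_ | i)
    · obtain ⟨x, hx⟩ := hd (k - 1)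
      exact ⟨x, by rw [mul_assoc, hx, ← pow_succ', Nat.sub_add_cancel hk, hg, pow_zero]⟩
    · obtain ⟨x, hx⟩ := hd i
      exact ⟨x, by rw [mul_assoc, hx, pow_succ']⟩
  have hdeg : deg (g * d) = deg d := by
    have h : k * Multiplicative.toAdd (degree g) = 0 := by
      simpa using congrArg (fun x => Multiplicative.toAdd (degree x)) hg
    have h' : Multiplicative.toAdd (degree g) = 0 := by
      rcases mul_eq_zero.1 h with h | h
      · omega
      · exact h
    simp [deg, h']
  obtain ⟨x, y, hxy, hz⟩ := exists_common_mul (fun i : ℕ => g ^ i) hd hgd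
  have hle := hmax _ ⟨_, hz, rfl⟩
  have hx := deg_mul d x
  have hy := deg_mul (g * d) y
  rw [← hxy] at hy
  rw [eq_one_of_length_eq_zero (x := x) (by omega),
    eq_one_of_length_eq_zero (x := y) (by omega), map_one, mul_one, mul_one] at hxy
  simpa using hxy.symm

/-- A relation between positive braids that holds up to a central factor still holds, with the same
factor, after shifting all generators. -/
theorem ofPositive_shift {b : StableBraidGroup} (hb : ∀ x, Commute b (ofPositive x))
    {u v : List ℕ} (h : b * ofPositive (ofWord v) = ofPositive (ofWord u)) (k : ℕ) :
    b * ofPositive (ofWord (v.map (· + k))) = ofPositive (ofWord (u.map (· + k))) := by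
  induction k with
  | zero => simpa using h
  | succ k ih =>
    have key : ∀ (n : ℕ) (w : List ℕ), (∀ i ∈ w, i + 1 < n) →
        coxeter 0 n * ofWord w = ofWord (w.map (· + 1)) * coxeter 0 n := by
      intro n w hw
      induction w with
      | nil => simp [ofWord_nil]
      | cons i w ihw =>
        simp only [List.mem_cons, forall_eq_or_imp] at hw
        rw [ofWord_cons, ← mul_assoc, (coxeter_semiconjBy hw.1).eq, mul_assoc, ihw hw.2,
          List.map_cons, ofWord_cons, mul_assoc]
    set u' := u.map (· + k) with hu'
    set v' := v.map (· + k) with hv'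
    have hu := key (u'.sum + v'.sum + 2) u' fun i hi => by
      have := List.single_le_sum (l := u') (by simp) i hi
      omega
    have hv := key (u'.sum + v'.sum + 2) v' fun i hi => by
      have := List.single_le_sum (l := v') (by simp) i hi
      omega
    have hu := congrArg ofPositive hu
    have hv := congrArg ofPositive hv
    rw [map_mul, map_mul] at hu hv
    have e : ∀ w : List ℕ, w.map (· + (k + 1)) = (w.map (· + k)).map (· + 1) := fun w => by
      simp [Function.comp_def, add_assoc]
    rw [e, e, ← hu', ← hv']
    refine mul_right_cancel (b := ofPositive (coxeter 0 (u'.sum + v'.sum + 2))) ?_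
    rw [mul_assoc, ← hv, ← hu, ← ih, ← mul_assoc, (hb _).eq, mul_assoc]

/-- A central quotient of positive braids is trivial. -/
theorem eq_one_of_forall_commute {b : StableBraidGroup} (hb : ∀ x, Commute b (ofPositive x)) :
    b = 1 := by
  obtain ⟨x, y, h⟩ := exists_ofPositive_mul b
  obtain ⟨v, rfl⟩ := ofWord_surjective x
  obtain ⟨u, rfl⟩ := ofWord_surjective y
  rw [← (hb _).eq] at h
  set m := u.sum + v.sum + 1 with hm
  have hu : ∀ i ∈ u, i < m := fun i hi => by
    have := List.single_le_sum (l := u) (by simp) i hi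
    omega
  have hv : ∀ i ∈ v, i < m := fun i hi => by
    have := List.single_le_sum (l := v) (by simp) i hi
    omega
  have hs := ofPositive_shift hb h (m + 1)
  have huv : ofWord (v ++ u.map (· + (m + 1))) = ofWord (u ++ v.map (· + (m + 1))) := by
    apply ofPositive_injective
    rw [ofWord_append, ofWord_append, map_mul, map_mul, ← hs, ← h, ← mul_assoc, (hb _).eq]
  let f : ℕ → PositiveBraid := fun i => if i < m then gen i else 1
  have hf : ∀ w : List ℕ, (∀ i ∈ w, i < m) → ∀ w' : List ℕ,
      ((w ++ w'.map (· + (m + 1))).map f).prod = ofWord w := by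
    intro w hw w'
    rw [List.map_append, List.prod_append, List.map_map]
    have h₁ : (w'.map (f ∘ (· + (m + 1)))).prod = 1 := List.prod_eq_one (by simp [f]; omega)
    rw [h₁, mul_one]
    induction w with
    | nil => rfl
    | cons i w ih =>
      simp only [List.mem_cons, forall_eq_or_imp] at hw
      rw [List.map_cons, List.prod_cons, ih hw.2, ofWord_cons]
      simp [f, hw.1]
  have hmem : ∀ i ∈ v ++ u.map (· + (m + 1)), i ≠ m := by
    intro i hi
    rcases List.mem_append.1 hi with hi | hi
    · exact (hv i hi).ne
    · obtain ⟨j, -, rfl⟩ := List.mem_map.1 hi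
      omega
  have := (ofWord_eq_iff.1 huv).prod_map_eq f (fun i _ j _ hij => by
      simp only [f]
      split_ifs <;> simp [gen_comm (.inl hij)])
    (fun i hi hi' => by
      have h₁ := hmem i hi
      have h₂ := hmem _ hi'
      by_cases h : i < m
      · simp only [f, if_pos h, if_pos (show i + 1 < m by omega), mul_assoc]
        exact gen_braid (.inl rfl)
      · simp only [f, if_neg h, if_neg (show ¬i + 1 < m by omega)])
  rw [hf v hv, hf u hu] at this
  rwa [this, mul_eq_right] at h

end StableBraidGroup

namespace BraidGroup

open PositiveBraid StableBraidGroup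

theorem braidGen_comm {n : ℕ} {i j : Fin (n - 1)} (h : (i : ℕ) + 1 < j) :
    braidGen n i * braidGen n j = braidGen n j * braidGen n i := by
  have := PresentedGroup.one_of_mem (rels := braidRels n) (.inl ⟨i, j, h, rfl⟩)
  simp only [map_mul, map_inv] at this
  rw [mul_inv_eq_one, mul_inv_eq_iff_eq_mul] at this
  exact this

theorem braidGen_braid {n : ℕ} {i j : Fin (n - 1)} (h : (j : ℕ) = i + 1) :
    braidGen n i * braidGen n j * braidGen n i = braidGen n j * braidGen n i * braidGen n j := by
  have := PresentedGroup.one_of_mem (rels := braidRels n) (.inr ⟨i, j, h, rfl⟩)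
  simp only [map_mul, map_inv] at this
  rwa [mul_inv_eq_one] at this

/-- The map from the braid group on finitely many strands to the stable braid group. -/
noncomputable def toStable (n : ℕ) : BraidGroup n →* StableBraidGroup :=
  PresentedGroup.toGroup (f := fun i : Fin (n - 1) => ofPositive (gen i)) (by
    rintro r (⟨i, j, h, rfl⟩ | ⟨i, j, h, rfl⟩)
    · simp only [map_mul, map_inv, FreeGroup.lift_apply_of]
      rw [mul_inv_eq_one, mul_inv_eq_iff_eq_mul, ← map_mul, ← map_mul, gen_comm (.inl h)]
    · simp only [map_mul, map_inv, FreeGroup.lift_apply_of]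
      rw [mul_inv_eq_one, ← map_mul, ← map_mul, ← map_mul, ← map_mul, mul_assoc, mul_assoc,
        gen_braid (.inl h.symm)])

theorem toStable_braidGen (n : ℕ) (i : Fin (n - 1)) :
    toStable n (braidGen n i) = ofPositive (gen i) :=
  PresentedGroup.toGroup.of _

/-- The Artin generator with index `i`, or `1` if `i` is out of range. -/
def genOrOne (n i : ℕ) : BraidGroup n := if h : i < n - 1 then braidGen n ⟨i, h⟩ else 1

/-- The value of a positive word in the braid group on `n` strands. -/
def evalWord (n : ℕ) (w : List ℕ) : BraidGroup n := (w.map (genOrOne n)).prod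

theorem evalWord_cons (n i : ℕ) (w : List ℕ) :
    evalWord n (i :: w) = genOrOne n i * evalWord n w := by
  simp [evalWord]

theorem evalWord_append (n : ℕ) (u v : List ℕ) :
    evalWord n (u ++ v) = evalWord n u * evalWord n v := by
  simp [evalWord]

theorem evalWord_eq {n : ℕ} {u v : List ℕ} (hu : ∀ i ∈ u, i < n - 1)
    (h : ofWord u = ofWord v) : evalWord n u = evalWord n v := by
  refine (ofWord_eq_iff.1 h).prod_map_eq _ (fun i hi j hj hij => ?_) fun i hi hj => ?_
  · rw [genOrOne, genOrOne, dif_pos (hu i hi), dif_pos (hu j hj)]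
    exact braidGen_comm hij
  · rw [genOrOne, genOrOne, dif_pos (hu i hi), dif_pos (hu _ hj)]
    exact braidGen_braid rfl

theorem toStable_evalWord {n : ℕ} {w : List ℕ} (hw : ∀ i ∈ w, i < n - 1) :
    toStable n (evalWord n w) = ofPositive (ofWord w) := by
  induction w with
  | nil => simp [evalWord, ofWord_nil]
  | cons i w ih =>
    simp only [List.mem_cons, forall_eq_or_imp] at hw
    rw [evalWord_cons, map_mul, ih hw.2, genOrOne, dif_pos hw.1, toStable_braidGen, ofWord_cons,
      map_mul]

theorem exists_mul_evalWord (n : ℕ) (a : BraidGroup n) :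
    ∃ u v : List ℕ, (∀ i ∈ u, i < n - 1) ∧ (∀ i ∈ v, i < n - 1) ∧
      a * evalWord n v = evalWord n u := by
  have ha : a ∈ Subgroup.closure (Set.range (PresentedGroup.of (rels := braidRels n))) := by
    rw [PresentedGroup.closure_range_of]
    trivial
  induction ha using Subgroup.closure_induction_left with
  | one => exact ⟨[], [], by simp, by simp, by simp [evalWord]⟩
  | mul_left x hx y _ ih =>
    obtain ⟨i, rfl⟩ := hx
    obtain ⟨u, v, hu, hv, h⟩ := ih
    refine ⟨i :: u, v, by simpa using hu, hv, ?_⟩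
    rw [mul_assoc, h, evalWord_cons, genOrOne, dif_pos i.2]
    rfl
  | inv_mul_cancel x hx y _ ih =>
    obtain ⟨i, rfl⟩ := hx
    obtain ⟨u, v, hu, hv, h⟩ := ih
    have hi := i.2
    have hle : ∀ {j : ℕ}, j ≤ n - 2 ↔ j < n - 1 := by omega
    obtain ⟨_, ⟨p, hp, rfl⟩, _, ⟨q, hq, rfl⟩, hpq⟩ :=
      exists_common_right_multiple (n := n - 2) (gen_mem_bounded (hle.2 hi))
        (ofWord_mem_bounded_iff.2 fun j hj => hle.2 (hu j hj))
    simp only [hle] at hp hq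
    refine ⟨p, v ++ q, hp, fun j hj => (List.mem_append.1 hj).elim (hv j) (hq j), ?_⟩
    have := evalWord_eq (n := n) (u := i :: p) (v := u ++ q) (by simpa using hp) hpq
    rw [evalWord_cons, evalWord_append, genOrOne, dif_pos hi] at this
    rw [evalWord_append, mul_assoc, ← mul_assoc y, h, ← this]
    exact inv_mul_cancel_left _ _

theorem toStable_injective (n : ℕ) : Function.Injective (toStable n) := by
  rw [injective_iff_map_eq_one]
  intro a ha
  obtain ⟨u, v, hu, hv, h⟩ := exists_mul_evalWord n a
  have h' := congrArg (toStable n) h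
  rw [map_mul, ha, one_mul, toStable_evalWord hu, toStable_evalWord hv] at h'
  rwa [evalWord_eq hv (ofPositive_injective h'), mul_eq_right] at h

theorem toStable_commute_gen {n j : ℕ} (hj : n ≤ j) (a : BraidGroup n) :
    Commute (toStable n a) (ofPositive (gen j)) := by
  refine PresentedGroup.generated_by _
    ((Subgroup.centralizer {ofPositive (gen j)}).comap (toStable n)) (fun i => ?_) a |>
      fun h => (Subgroup.mem_centralizer_singleton_iff.1 h)
  rw [Subgroup.mem_comap, Subgroup.mem_centralizer_singleton_iff]
  change toStable n (braidGen n i) * _ = _ * toStable n (braidGen n i)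
  rw [toStable_braidGen, ← map_mul, ← map_mul, gen_comm (.inl (by omega))]

end BraidGroup

/-- For every nontrivial `a ∈ B_m`, the image of `η(a)` in the quotient of `B_n` by its
center has infinite order. -/
theorem standard_geometric_embedding_infinite_order_mod_center (m n : ℕ) (hmn : m < n)
    (η : BraidGroup m →* BraidGroup n)
    (hη : ∀ i : Fin (m - 1),
      η (braidGen m i) = braidGen n (Fin.castLE (by omega) i))
    (a : BraidGroup m) (ha : a ≠ 1) :
    ¬ IsOfFinOrder (QuotientGroup.mk' (Subgroup.center (BraidGroup n)) (η a)) := by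
  intro hfin
  obtain ⟨k, hk, hpow⟩ := isOfFinOrder_iff_pow_eq_one.1 hfin
  rw [← map_pow, ← map_pow, QuotientGroup.mk'_apply, QuotientGroup.eq_one_iff] at hpow
  have hη' : (BraidGroup.toStable n).comp η = BraidGroup.toStable m :=
    PresentedGroup.ext fun i => by
      change BraidGroup.toStable n (η (braidGen m i)) = BraidGroup.toStable m (braidGen m i)
      rw [hη, BraidGroup.toStable_braidGen, BraidGroup.toStable_braidGen, Fin.val_castLE]
  have hgen : ∀ i, Commute (BraidGroup.toStable m (a ^ k))
      (StableBraidGroup.ofPositive (PositiveBraid.gen i)) := by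
    intro i
    by_cases hi : i < n - 1
    · have h := Subgroup.mem_center_iff.1 hpow (braidGen n ⟨i, hi⟩)
      rw [← hη', MonoidHom.comp_apply, ← BraidGroup.toStable_braidGen n ⟨i, hi⟩]
      exact (Commute.map (show Commute _ _ from h) (BraidGroup.toStable n)).symm
    · exact BraidGroup.toStable_commute_gen (by omega) _
  have hcomm : ∀ x, Commute (BraidGroup.toStable m (a ^ k)) (StableBraidGroup.ofPositive x) := by
    intro x
    obtain ⟨w, rfl⟩ := PositiveBraid.ofWord_surjective x
    induction w with
    | nil =>
      rw [PositiveBraid.ofWord_nil, map_one]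
      exact Commute.one_right _
    | cons i w ih =>
      rw [PositiveBraid.ofWord_cons, map_mul]
      exact (hgen i).mul_right ih
  have h := StableBraidGroup.eq_one_of_forall_commute hcomm
  rw [map_pow] at h
  exact ha (BraidGroup.toStable_injective m
    ((StableBraidGroup.eq_one_of_pow_eq_one hk h).trans (map_one (BraidGroup.toStable m)).symm))
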